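/- Spectral description of the nil-Dunkl operators on q-Hermite polynomials: Ȳ(Ē_n) = q^{-n/2}·Ē_n for n ≥ 1 and Ȳ(Ē_n) = 0 for n ≤ 0; Ȳ'(Ē_n) = q^{n/2}·Ē_n for n ≤ 0 and Ȳ'(Ē_n) = 0 for n ≥ 1; moreover Ȳ ∘ Ȳ' = 0 = Ȳ' ∘ Ȳ as operators on L. Consequently the symmetric q-Hermite polynomials P̄_n := Ē_{−n} (n ≥ 0) satisfy the difference eigenvalue equation (Ȳ + Ȳ')(P̄_n) = q^{-n/2}·P̄_n. -/

import Mathlib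

/-!
Nonsymmetric continuous q-Hermite polynomials of type A₁ over `K = ℚ(u)`, `q = u⁴`,
together with the nil-Dunkl operators.  The Laurent polynomials `K[X,X⁻¹]` are regarded
inside the ambient field `MK = K(X)`, in which all the operators are given by the same
formulas (the division by `1 - X²` is then unproblematic).
-/

noncomputable section

/-- The ground field `K = ℚ(u)`. -/
abbrev K : Type := RatFunc ℚ

/-- `u`, with `q = u⁴` (so `u = q^{1/4}`). -/
def u : K := RatFunc.X

/-- `q = u⁴`. -/
def q : K := u ^ 4

/-- The ambient field `K(X)` containing the Laurent polynomials `K[X,X⁻¹]`. -/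
abbrev MK : Type := RatFunc K

/-- The variable `X`. -/
def XM : MK := RatFunc.X

/-- The involution `s : Xⁿ ↦ X⁻ⁿ` (the substitution `X ↦ X⁻¹`). -/
def sOp : MK → MK := RatFunc.eval RatFunc.C (XM⁻¹)

/-- The operator `π : Xⁿ ↦ q^{n/2}X⁻ⁿ` (the substitution `X ↦ q^{1/2}X⁻¹`). -/
def piOp : MK → MK := RatFunc.eval RatFunc.C (RatFunc.C (u ^ 2) * XM⁻¹)

/-- The nil-Hecke operator `T̄(f) = (s(f) - f)/(1 - X²)`. -/
def Tbar (f : MK) : MK := (sOp f - f) / (1 - XM ^ 2)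

/-- The nil-Dunkl operator `Ȳ = π ∘ T̄`. -/
def Ybar (f : MK) : MK := piOp (Tbar f)

/-- The operator `Ȳ'(f) = T̄(π(f)) + π(f)`. -/
def Ybar' (f : MK) : MK := Tbar (piOp f) + piOp f

/-- `∏_{i=0}^{j-1}(1-q^{n-i-1})/(1-q^{1+i})`. -/
def hermProdPos (n j : ℕ) : K :=
  ∏ i ∈ Finset.range j, (1 - q ^ ((n : ℤ) - i - 1)) / (1 - q ^ ((i : ℤ) + 1))

/-- `∏_{i=0}^{j-1}(1-q^{n-i})/(1-q^{1+i})`. -/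
def hermProdNeg (n j : ℕ) : K :=
  ∏ i ∈ Finset.range j, (1 - q ^ ((n : ℤ) - i)) / (1 - q ^ ((i : ℤ) + 1))

/-- `Ē_n` for `n ≥ 1`. -/
def EHpos (n : ℕ) : MK :=
  XM ^ (n : ℤ)
    + ∑ j ∈ Finset.Icc 1 (n / 2),
        RatFunc.C (q ^ ((n : ℤ) - j) * (1 - q ^ (j : ℤ)) / (1 - q ^ ((n : ℤ) - j)) *
          hermProdPos n j) * XM ^ (2 * (j : ℤ) - n)
    + ∑ j ∈ Finset.Icc 1 ((n - 1) / 2),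
        RatFunc.C (q ^ (j : ℤ) * hermProdPos n j) * XM ^ ((n : ℤ) - 2 * j)

/-- `Ē_{-n}` for `n ≥ 1`. -/
def EHneg (n : ℕ) : MK :=
  XM ^ (-(n : ℤ)) + XM ^ (n : ℤ)
    + ∑ j ∈ Finset.Icc 1 (n / 2), RatFunc.C (hermProdNeg n j) * XM ^ (2 * (j : ℤ) - n)
    + ∑ j ∈ Finset.Icc 1 ((n - 1) / 2), RatFunc.C (hermProdNeg n j) * XM ^ ((n : ℤ) - 2 * j)

/-- The nonsymmetric continuous q-Hermite polynomials `Ē_n`, `n ∈ ℤ`. -/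
def EH : ℤ → MK := fun n => if 0 < n then EHpos n.toNat else if n = 0 then 1 else EHneg (-n).toNat
/-! ### Ring homomorphism property of the substitutions -/

lemma herm_XM_ne : XM ≠ 0 := RatFunc.X_ne_zero

lemma herm_u_ne : u ≠ 0 := RatFunc.X_ne_zero

lemma herm_eval_ne (c : K) (hc : c ≠ 0) (p : Polynomial K) (hp : p ≠ 0) :
    p.eval₂ (RatFunc.C : K →+* MK) (RatFunc.C c * XM⁻¹) ≠ 0 := by
  intro h
  have halg : IsAlgebraic K (RatFunc.C c * XM⁻¹ : MK) := ⟨p, hp, h⟩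
  have h2 : IsAlgebraic K (RatFunc.C c⁻¹ * (RatFunc.C c * XM⁻¹) : MK) :=
    (isAlgebraic_algebraMap (R := K) (A := MK) c⁻¹).mul halg
  rw [← mul_assoc, ← map_mul, inv_mul_cancel₀ hc, map_one, one_mul, IsAlgebraic.inv_iff] at h2
  exact RatFunc.transcendental_X h2

/-- Substitution `X ↦ c X⁻¹` as a ring homomorphism. -/
def hermHom (c : K) (hc : c ≠ 0) : MK →+* MK where
  toFun := RatFunc.eval RatFunc.C (RatFunc.C c * XM⁻¹)
  map_one' := RatFunc.eval_one _ _
  map_zero' := RatFunc.eval_zero _ _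
  map_mul' x y := RatFunc.eval_mul _ _ (herm_eval_ne c hc _ (RatFunc.denom_ne_zero x))
    (herm_eval_ne c hc _ (RatFunc.denom_ne_zero y))
  map_add' x y := RatFunc.eval_add _ _ (herm_eval_ne c hc _ (RatFunc.denom_ne_zero x))
    (herm_eval_ne c hc _ (RatFunc.denom_ne_zero y))

lemma hermHom_C (c : K) (hc : c ≠ 0) (a : K) : hermHom c hc (RatFunc.C a) = RatFunc.C a :=
  RatFunc.eval_C _ _

lemma hermHom_X (c : K) (hc : c ≠ 0) : hermHom c hc XM = RatFunc.C c * XM⁻¹ :=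
  RatFunc.eval_X _ _

/-- `s` as a ring homomorphism. -/
def sH : MK →+* MK := hermHom 1 one_ne_zero

/-- `π` as a ring homomorphism. -/
def pH : MK →+* MK := hermHom (u ^ 2) (pow_ne_zero 2 herm_u_ne)

lemma sOp_eq (f : MK) : sOp f = sH f := by
  show RatFunc.eval RatFunc.C XM⁻¹ f = RatFunc.eval RatFunc.C (RatFunc.C 1 * XM⁻¹) f
  rw [map_one, one_mul]

lemma piOp_eq (f : MK) : piOp f = pH f := rfl

lemma sH_C (a : K) : sH (RatFunc.C a) = RatFunc.C a := hermHom_C _ _ a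
lemma pH_C (a : K) : pH (RatFunc.C a) = RatFunc.C a := hermHom_C _ _ a
lemma sH_X : sH XM = XM⁻¹ := by
  have := hermHom_X 1 one_ne_zero
  simpa [sH] using this
lemma pH_X : pH XM = RatFunc.C (u ^ 2) * XM⁻¹ := hermHom_X _ _

lemma herm_Cu_ne : (RatFunc.C (u ^ 2) : MK) ≠ 0 :=
  (map_ne_zero _).2 (pow_ne_zero 2 herm_u_ne)

/-- Two ring endomorphisms of `K(X)` fixing constants and `X` agree. -/
lemma herm_hom_id (g : MK →+* MK) (hC : ∀ a, g (RatFunc.C a) = RatFunc.C a) (hX : g XM = XM)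
    (f : MK) : g f = f := by
  have hp : ∀ p : Polynomial K, g (algebraMap _ MK p) = algebraMap _ MK p := by
    intro p
    induction p using Polynomial.induction_on' with
    | add p r hp hr => simp [hp, hr]
    | monomial n a =>
      have hX' : g RatFunc.X = RatFunc.X := hX
      rw [← Polynomial.C_mul_X_pow_eq_monomial]
      simp [hX', hC]
  rw [← RatFunc.num_div_denom f, map_div₀, hp, hp]

lemma sH_sH (f : MK) : sH (sH f) = f :=
  herm_hom_id (sH.comp sH) (fun a => by simp [sH_C]) (by simp [sH_X]) f

lemma pH_pH (f : MK) : pH (pH f) = f := by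
  refine herm_hom_id (pH.comp pH) (fun a => by simp [pH_C]) ?_ f
  have h1 := herm_Cu_ne
  have h2 := herm_XM_ne
  rw [RingHom.comp_apply, pH_X, map_mul, pH_C, map_inv₀, pH_X]
  field_simp

lemma herm_X2_ne : (1 - XM ^ 2 : MK) ≠ 0 := by
  intro h
  have h1 : (Polynomial.X ^ 2 : Polynomial K) = 1 := by
    apply RatFunc.algebraMap_injective K
    simp only [map_pow, map_one, RatFunc.algebraMap_X]
    exact (sub_eq_zero.1 h).symm
  have := congrArg Polynomial.natDegree h1
  simp at this

lemma Tbar_eq (f : MK) : Tbar f = (sH f - f) / (1 - XM ^ 2) := by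
  rw [Tbar, sOp_eq]

lemma sH_Tbar (f : MK) : sH (Tbar f) = XM ^ 2 * Tbar f := by
  have h1 := herm_X2_ne
  have h2 := herm_XM_ne
  have h3 : (1 - (XM⁻¹) ^ 2 : MK) ≠ 0 := by
    intro h
    apply h1
    field_simp at h
    linear_combination -h
  rw [Tbar_eq, map_div₀, map_sub, sH_sH, map_sub, map_one, map_pow, sH_X, ← mul_div_assoc,
    div_eq_div_iff h3 h1]
  field_simp
  ring

lemma Tbar_Tbar (f : MK) : Tbar (Tbar f) + Tbar f = 0 := by
  have h1 := herm_X2_ne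
  rw [Tbar_eq (Tbar f), sH_Tbar]
  field_simp
  ring

lemma Tbar_add (f g : MK) : Tbar (f + g) = Tbar f + Tbar g := by
  simp only [Tbar_eq, map_add]; ring

lemma Ybar_Ybar' (f : MK) : Ybar (Ybar' f) = 0 := by
  rw [Ybar, Ybar', Tbar_add, Tbar_Tbar, piOp_eq, map_zero]

lemma Ybar'_Ybar (f : MK) : Ybar' (Ybar f) = 0 := by
  rw [Ybar, Ybar', piOp_eq, piOp_eq, pH_pH, Tbar_Tbar]

/-! ### Gaussian binomials -/

lemma herm_q_ne : q ≠ 0 := pow_ne_zero 4 herm_u_ne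

lemma herm_q_pow (k : ℕ) : (1 - q ^ (k + 1) : K) ≠ 0 := by
  intro h
  have h1 : (Polynomial.X ^ (4 * (k + 1)) : Polynomial ℚ) = 1 := by
    apply RatFunc.algebraMap_injective ℚ
    simp only [map_pow, map_one, RatFunc.algebraMap_X]
    rw [pow_mul]
    exact (sub_eq_zero.1 h).symm
  have := congrArg Polynomial.natDegree h1
  simp at this

lemma hermG_zero (n : ℕ) : hermProdNeg n 0 = 1 := by simp [hermProdNeg]

lemma hermG_succ (n k : ℕ) :
    hermProdNeg n (k + 1) * (1 - q ^ (k + 1)) = hermProdNeg n k * (1 - q ^ ((n : ℤ) - k)) := by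
  have h := herm_q_pow k
  have e : (q : K) ^ ((k : ℤ) + 1) = q ^ (k + 1) := by exact_mod_cast zpow_natCast q (k + 1)
  rw [hermProdNeg, Finset.prod_range_succ, ← hermProdNeg, e, mul_assoc, div_mul_cancel₀ _ h]

lemma hermG_succ_self (n : ℕ) : hermProdNeg n (n + 1) = 0 := by
  have h := hermG_succ n n
  simp only [sub_self, zpow_zero, mul_zero] at h
  exact (mul_eq_zero.1 h).resolve_right (herm_q_pow n)

/-- `(q;q)_m`. -/
def hermF (m : ℕ) : K := ∏ i ∈ Finset.range m, (1 - q ^ (i + 1))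

lemma hermF_ne (m : ℕ) : hermF m ≠ 0 := Finset.prod_ne_zero_iff.2 fun i _ => herm_q_pow i

lemma hermG_F (m k : ℕ) : hermProdNeg (m + k) k * (hermF k * hermF m) = hermF (m + k) := by
  have key : ∀ k m n : ℕ, m + k = n → hermProdNeg n k * (hermF k * hermF m) = hermF n := by
    intro k
    induction k with
    | zero => rintro m n rfl; simp [hermG_zero, hermF]
    | succ k ih =>
      intro m n h
      have h1 := ih (m + 1) n (by omega)
      have h2 := hermG_succ n k
      have e : (q : K) ^ ((n : ℤ) - k) = q ^ (m + 1) := by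
        rw [show ((n : ℤ) - k) = ((m + 1 : ℕ) : ℤ) by omega, zpow_natCast]
      have f1 : hermF (k + 1) = hermF k * (1 - q ^ (k + 1)) := Finset.prod_range_succ _ _
      have f2 : hermF (m + 1) = hermF m * (1 - q ^ (m + 1)) := Finset.prod_range_succ _ _
      rw [e] at h2
      rw [f2] at h1
      rw [f1]
      linear_combination h1 + hermF k * hermF m * h2
  exact key k m _ rfl

lemma hermG_symm (n k : ℕ) (h : k ≤ n) : hermProdNeg n (n - k) = hermProdNeg n k := by
  obtain ⟨m, rfl⟩ := Nat.exists_eq_add_of_le h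
  have h1 := hermG_F m k
  have h2 := hermG_F k m
  rw [Nat.add_comm m k] at h1
  rw [Nat.add_sub_cancel_left]
  have := mul_ne_zero (hermF_ne k) (hermF_ne m)
  apply mul_right_cancel₀ this
  rw [h1, mul_comm (hermF k), h2]

lemma hermPos_eq (n j : ℕ) : hermProdPos (n + 1) j = hermProdNeg n j := by
  unfold hermProdPos hermProdNeg
  refine Finset.prod_congr rfl fun i _ => ?_
  rw [show ((n + 1 : ℕ) : ℤ) - i - 1 = (n : ℤ) - i by push_cast; ring]

/-! ### Uniform sum formulas -/

lemma herm_split (f : ℕ → MK) (n : ℕ) :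
    ∑ k ∈ Finset.range (n + 1), f k = f 0 + ∑ j ∈ Finset.Icc 1 ((n + 1) / 2), f (n + 1 - j)
      + ∑ j ∈ Finset.Icc 1 (n / 2), f j := by
  have e1 : Finset.Icc 1 ((n + 1) / 2) = Finset.Ico 1 ((n + 1) / 2 + 1) := by
    ext; simp only [Finset.mem_Icc, Finset.mem_Ico]; omega
  have e2 : Finset.Icc 1 (n / 2) = Finset.Ico 1 (n / 2 + 1) := by
    ext; simp only [Finset.mem_Icc, Finset.mem_Ico]; omega
  rw [e1, e2, Finset.sum_Ico_reflect f 1 (by omega : (n + 1) / 2 + 1 ≤ n + 1 + 1),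
    show n + 1 + 1 - ((n + 1) / 2 + 1) = n / 2 + 1 by omega, show n + 1 + 1 - 1 = n + 1 by omega,
    add_assoc, add_comm (Finset.sum _ _), Finset.sum_Ico_consecutive f (by omega) (by omega),
    Finset.range_eq_Ico, Finset.sum_eq_sum_Ico_succ_bot (by omega)]

/-- Symmetric q-Hermite polynomial. -/
def hermP (n : ℕ) : MK :=
  ∑ k ∈ Finset.range (n + 1), RatFunc.C (hermProdNeg n k) * XM ^ ((n : ℤ) - 2 * k)

/-- `X⁻¹ Ē_{n+1}`. -/
def hermQ (n : ℕ) : MK :=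
  ∑ k ∈ Finset.range (n + 1), RatFunc.C (q ^ k * hermProdNeg n k) * XM ^ ((n : ℤ) - 2 * k)

lemma EHneg_eq (n : ℕ) : EHneg (n + 1) = hermP (n + 1) := by
  rw [hermP, Finset.sum_range_succ, herm_split, EHneg]
  have h0 : hermProdNeg (n + 1) (n + 1) = 1 := by
    have := hermG_symm (n + 1) 0 (by omega)
    simpa [hermG_zero] using this
  have e : ∑ j ∈ Finset.Icc 1 ((n + 1) / 2),
      RatFunc.C (hermProdNeg (n + 1) (n + 1 - j)) * XM ^ (((n + 1 : ℕ) : ℤ) - 2 * ((n + 1 - j : ℕ) : ℤ))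
      = ∑ j ∈ Finset.Icc 1 ((n + 1) / 2),
      RatFunc.C (hermProdNeg (n + 1) j) * XM ^ (2 * (j : ℤ) - ((n + 1 : ℕ) : ℤ)) := by
    refine Finset.sum_congr rfl fun j hj => ?_
    rw [Finset.mem_Icc] at hj
    rw [hermG_symm _ _ (by omega)]
    congr 2
    omega
  rw [e, h0, hermG_zero]
  simp only [map_one, one_mul, Nat.add_sub_cancel, Nat.cast_zero, mul_zero, sub_zero]
  rw [show ((n + 1 : ℕ) : ℤ) - 2 * ((n + 1 : ℕ) : ℤ) = -((n + 1 : ℕ) : ℤ) by ring]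
  ring

lemma EHpos_eq (n : ℕ) : EHpos (n + 1) = XM * hermQ n := by
  have hX : ∀ m : ℤ, XM * XM ^ m = XM ^ (m + 1) := fun m => by
    rw [zpow_add_one₀ herm_XM_ne, mul_comm]
  rw [hermQ, Finset.mul_sum, herm_split, EHpos]
  simp only [Nat.add_sub_cancel]
  congr 1
  · congr 1
    · simp [hermG_zero]
      norm_cast
      rw [pow_succ, mul_comm]
    · refine Finset.sum_congr rfl fun j hj => ?_
      rw [Finset.mem_Icc] at hj
      obtain ⟨i, rfl⟩ : ∃ i, j = i + 1 := ⟨j - 1, by omega⟩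
      obtain ⟨r, rfl⟩ : ∃ r, n = i + 1 + r := ⟨n - (i + 1), by omega⟩
      rw [mul_left_comm, hX, hermPos_eq]
      have e1 : i + 1 + r + 1 - (i + 1) = r + 1 := by omega
      have e2 : (((i + 1 + r + 1 : ℕ) : ℤ) - ((i + 1 : ℕ) : ℤ)) = ((r + 1 : ℕ) : ℤ) := by
        push_cast; ring
      have e3 : hermProdNeg (i + 1 + r) (r + 1) = hermProdNeg (i + 1 + r) i := by
        rw [← hermG_symm _ i (by omega)]; congr 1; omega
      have e4 := hermG_succ (i + 1 + r) i
      rw [show ((i + 1 + r : ℕ) : ℤ) - (i : ℤ) = ((r + 1 : ℕ) : ℤ) by push_cast; ring,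
        zpow_natCast] at e4
      rw [e1, e2, e3, zpow_natCast, zpow_natCast]
      congr 2
      · have := herm_q_pow r
        rw [div_mul_eq_mul_div, div_eq_iff this]
        linear_combination q ^ (r + 1) * e4
      · push_cast; ring
  · refine Finset.sum_congr rfl fun j hj => ?_
    rw [mul_left_comm, hX, hermPos_eq, zpow_natCast]
    congr 2
    push_cast; ring

lemma herm_reflect (n : ℕ) (g : ℕ → K) (a : ℕ → ℤ) (b : ℕ → K) (c : ℕ → ℤ)
    (h : ∀ k i, k + i = n → a i = c k ∧ g i = b k) :
    ∑ k ∈ Finset.range (n + 1), RatFunc.C (g k) * XM ^ a k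
      = ∑ k ∈ Finset.range (n + 1), (RatFunc.C (b k) * XM ^ c k : MK) := by
  rw [← Finset.sum_range_reflect]
  refine Finset.sum_congr rfl fun k hk => ?_
  rw [Finset.mem_range] at hk
  obtain ⟨h1, h2⟩ := h k (n + 1 - 1 - k) (by omega)
  rw [h1, h2]

lemma sH_zpow (m : ℤ) : sH (XM ^ m) = XM ^ (-m) := by
  rw [map_zpow₀, sH_X, inv_zpow', ]

lemma pH_zpow (m : ℤ) : pH (XM ^ m) = RatFunc.C ((u ^ 2) ^ m) * XM ^ (-m) := by
  rw [map_zpow₀, pH_X, mul_zpow, inv_zpow', map_zpow₀]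

lemma hermG_symm' (n k i : ℕ) (h : k + i = n) : hermProdNeg n i = hermProdNeg n k := by
  rw [← hermG_symm n k (by omega)]; congr 1; omega

lemma sH_P (n : ℕ) : sH (hermP n) = hermP n := by
  rw [hermP, map_sum]
  simp only [map_mul, sH_C, sH_zpow]
  apply herm_reflect
  intro k i h
  exact ⟨by omega, hermG_symm' n k i h⟩

lemma pH_P (n : ℕ) : pH (hermP n) = RatFunc.C ((u ^ 2) ^ (-(n : ℤ))) * hermQ n := by
  rw [hermP, hermQ, map_sum, Finset.mul_sum]
  simp only [map_mul (f := pH), pH_C, pH_zpow, ← mul_assoc, ← map_mul]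
  apply herm_reflect
  intro k i h
  refine ⟨by omega, ?_⟩
  rw [hermG_symm' n k i h]
  have hu : (u ^ 2 : K) ≠ 0 := pow_ne_zero 2 herm_u_ne
  have : (u ^ 2 : K) ^ ((n : ℤ) - 2 * i) = (u ^ 2) ^ (-(n : ℤ)) * q ^ k := by
    have hq : (q : K) ^ k = (u ^ 2) ^ ((2 * k : ℕ) : ℤ) := by
      rw [zpow_natCast, q, pow_mul, ← pow_mul u 2 2]
    rw [hq, ← zpow_add₀ hu]
    congr 1
    push_cast
    omega
  rw [this]; ring

lemma pH_Q (n : ℕ) : pH (hermQ n) = RatFunc.C ((u ^ 2) ^ (n : ℤ)) * hermP n := by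
  have hu : (u ^ 2 : K) ≠ 0 := pow_ne_zero 2 herm_u_ne
  have h := congrArg pH (pH_P n)
  rw [pH_pH, map_mul, pH_C] at h
  rw [h, ← mul_assoc, ← map_mul, ← zpow_add₀ hu, add_neg_cancel, zpow_zero, map_one, one_mul]

/-- Key identity `s Ē_{n+1} - Ē_{n+1} = (X⁻¹ - X) P̄_n`. -/
lemma herm_key (n : ℕ) :
    XM⁻¹ * sH (hermQ n) - XM * hermQ n = (XM⁻¹ - XM) * hermP n := by
  have hX : ∀ m : ℤ, XM * XM ^ m = XM ^ (m + 1) := fun m => by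
    rw [zpow_add_one₀ herm_XM_ne, mul_comm]
  have hX' : ∀ m : ℤ, XM⁻¹ * XM ^ m = XM ^ (m - 1) := fun m => by
    rw [zpow_sub_one₀ herm_XM_ne, mul_comm]
  have h1 : sH (hermQ n) = ∑ k ∈ Finset.range (n + 1),
      RatFunc.C (q ^ ((n : ℤ) - k) * hermProdNeg n k) * XM ^ ((n : ℤ) - 2 * k) := by
    rw [hermQ, map_sum]
    simp only [map_mul (f := sH), sH_C, sH_zpow]
    apply herm_reflect
    intro k i h
    refine ⟨by omega, ?_⟩
    rw [hermG_symm' n k i h, show (n : ℤ) - k = (i : ℤ) by omega, zpow_natCast]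
  let a : ℕ → MK := fun k =>
    RatFunc.C (hermProdNeg n k * (q ^ k - 1)) * XM ^ ((n : ℤ) + 1 - 2 * k)
  have hL : XM⁻¹ * sH (hermQ n) - XM⁻¹ * hermP n = ∑ k ∈ Finset.range (n + 1), a (k + 1) := by
    rw [h1, hermP, Finset.mul_sum, Finset.mul_sum, ← Finset.sum_sub_distrib]
    refine Finset.sum_congr rfl fun k _ => ?_
    have e : hermProdNeg n (k + 1) * (q ^ (k + 1) - 1)
        = q ^ ((n : ℤ) - k) * hermProdNeg n k - hermProdNeg n k := by
      linear_combination -hermG_succ n k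
    simp only [a]
    rw [e, mul_left_comm, hX', mul_left_comm, hX', map_sub, sub_mul,
      show (n : ℤ) + 1 - 2 * ((k + 1 : ℕ) : ℤ) = (n : ℤ) - 2 * k - 1 by push_cast; ring]
  have hR : XM * hermQ n - XM * hermP n = ∑ k ∈ Finset.range (n + 1), a k := by
    rw [hermQ, hermP, Finset.mul_sum, Finset.mul_sum, ← Finset.sum_sub_distrib]
    refine Finset.sum_congr rfl fun k _ => ?_
    simp only [a]
    rw [mul_left_comm, hX, mul_left_comm, hX, ← sub_mul, ← map_sub,
      show (n : ℤ) + 1 - 2 * (k : ℤ) = (n : ℤ) - 2 * k + 1 by ring]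
    congr 2
    ring
  have ha0 : a 0 = 0 := by simp [a]
  have han : a (n + 1) = 0 := by simp [a, hermG_succ_self]
  have hs : ∑ k ∈ Finset.range (n + 1), a (k + 1) = ∑ k ∈ Finset.range (n + 1), a k := by
    have := Finset.sum_range_succ' a (n + 1)
    rw [Finset.sum_range_succ, ha0, han, add_zero, add_zero] at this
    exact this.symm
  linear_combination hL - hR + hs

lemma herm_EHpos_sub (n : ℕ) :
    sH (XM * hermQ n) - XM * hermQ n = (XM⁻¹ - XM) * hermP n := by
  rw [map_mul, sH_X, herm_key]

lemma Tbar_E (n : ℕ) : Tbar (XM * hermQ n) = XM⁻¹ * hermP n := by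
  have h1 := herm_X2_ne
  have h2 := herm_XM_ne
  rw [Tbar_eq, herm_EHpos_sub, div_eq_iff h1]
  field_simp

lemma Ybar_E (n : ℕ) : Ybar (XM * hermQ n)
    = RatFunc.C ((u ^ 2) ^ (-((n + 1 : ℕ) : ℤ))) * (XM * hermQ n) := by
  have hu : (u ^ 2 : K) ≠ 0 := pow_ne_zero 2 herm_u_ne
  have h1 := herm_Cu_ne
  have h2 := herm_XM_ne
  rw [Ybar, Tbar_E, piOp_eq, map_mul, map_inv₀, pH_X, pH_P, Nat.cast_succ, neg_add,
    zpow_add₀ hu, map_mul, zpow_neg_one, map_inv₀]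
  field_simp

lemma Ybar'_E (n : ℕ) : Ybar' (XM * hermQ n) = 0 := by
  have h1 := herm_X2_ne
  have h2 := herm_XM_ne
  rw [Ybar', piOp_eq, map_mul, pH_X, pH_Q, Tbar_eq]
  simp only [map_mul (f := sH), map_inv₀, sH_C, sH_X, sH_P]
  field_simp
  ring

lemma Ybar_P (n : ℕ) : Ybar (hermP n) = 0 := by
  rw [Ybar, Tbar_eq, sH_P, sub_self, zero_div, piOp_eq, map_zero]

lemma Ybar'_P (n : ℕ) : Ybar' (hermP n) = RatFunc.C ((u ^ 2) ^ (-(n : ℤ))) * hermP n := by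
  have h1 := herm_X2_ne
  have h2 := herm_XM_ne
  have h := herm_key n
  rw [Ybar', piOp_eq, pH_P, Tbar_eq, map_mul, sH_C, div_add' _ _ _ h1, div_eq_iff h1]
  have h' : sH (hermQ n) - XM ^ 2 * hermQ n = (1 - XM ^ 2) * hermP n := by
    field_simp at h
    linear_combination h
  linear_combination RatFunc.C ((u ^ 2) ^ (-(n : ℤ))) * h'

lemma EH_pos (n : ℕ) : EH ((n + 1 : ℕ) : ℤ) = XM * hermQ n := by
  rw [EH, if_pos (by omega), Int.toNat_natCast, EHpos_eq]

lemma EH_neg (n : ℕ) : EH (-(n : ℤ)) = hermP n := by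
  rcases n with _ | n
  · simp [EH, hermP, hermG_zero]
  · rw [EH, if_neg (by omega), if_neg (by omega), neg_neg, Int.toNat_natCast, EHneg_eq]


/-- Spectral description of the nil-Dunkl operators on q-Hermite polynomials:
`Ȳ(Ē_n) = q^{-n/2}·Ē_n` for `n ≥ 1` and `Ȳ(Ē_n) = 0` for `n ≤ 0`;
`Ȳ'(Ē_n) = q^{n/2}·Ē_n` for `n ≤ 0` and `Ȳ'(Ē_n) = 0` for `n ≥ 1`;
moreover `Ȳ ∘ Ȳ' = 0 = Ȳ' ∘ Ȳ` as operators.  Consequently the symmetric q-Hermite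
polynomials `P̄_n = Ē_{-n}` (`n ≥ 0`) satisfy `(Ȳ + Ȳ')(P̄_n) = q^{-n/2}·P̄_n`. -/
theorem hermite_nil_dunkl_spectrum :
    (∀ n : ℤ, 1 ≤ n → Ybar (EH n) = RatFunc.C ((u ^ 2) ^ (-n)) * EH n) ∧
    (∀ n : ℤ, n ≤ 0 → Ybar (EH n) = 0) ∧
    (∀ n : ℤ, n ≤ 0 → Ybar' (EH n) = RatFunc.C ((u ^ 2) ^ n) * EH n) ∧
    (∀ n : ℤ, 1 ≤ n → Ybar' (EH n) = 0) ∧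
    (∀ f : MK, Ybar (Ybar' f) = 0) ∧
    (∀ f : MK, Ybar' (Ybar f) = 0) ∧
    (∀ n : ℕ, Ybar (EH (-(n : ℤ))) + Ybar' (EH (-(n : ℤ)))
      = RatFunc.C ((u ^ 2) ^ (-(n : ℤ))) * EH (-(n : ℤ))) := by
  have hp : ∀ n : ℤ, 1 ≤ n → ∃ m : ℕ, n = ((m + 1 : ℕ) : ℤ) := fun n hn =>
    ⟨(n - 1).toNat, by omega⟩
  have hn : ∀ n : ℤ, n ≤ 0 → ∃ m : ℕ, n = -(m : ℤ) := fun n hn => ⟨(-n).toNat, by omega⟩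
  refine ⟨fun n h => ?_, fun n h => ?_, fun n h => ?_, fun n h => ?_, Ybar_Ybar', Ybar'_Ybar,
    fun n => ?_⟩
  · obtain ⟨m, rfl⟩ := hp n h
    rw [EH_pos, Ybar_E]
  · obtain ⟨m, rfl⟩ := hn n h
    rw [EH_neg, Ybar_P]
  · obtain ⟨m, rfl⟩ := hn n h
    rw [EH_neg, Ybar'_P]
  · obtain ⟨m, rfl⟩ := hp n h
    rw [EH_pos, Ybar'_E]
  · rw [EH_neg, Ybar_P, Ybar'_P, zero_add]
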